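/- (Completeness of CP for closed terms.) For all closed terms P, Q ∈ C_A, CP ⊢ P = Q if and only if se(P) = se(Q). -/

import Mathlib

/-- Evaluation trees over a set `A` of atoms, with leaves `T` and `F`. -/
inductive ETree (A : Type) : Type
  | leafT : ETree A
  | leafF : ETree A
  | node : ETree A → A → ETree A → ETree A

namespace ETree

/-- Leaf replacement `X[T↦Y, F↦Z]`. -/
def repl {A : Type} : ETree A → ETree A → ETree A → ETree A
  | leafT, y, _ => y
  | leafF, _, z => z
  | node l a r, y, z => node (repl l y z) a (repl r y z)

end ETree

/-- Closed terms over the conditional signature `Σ_CP(A) = {_◁_▷_, T, F, a | a ∈ A}`.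
`cond x y z` denotes Hoare's conditional `x ◁ y ▷ z` (if `y` then `x` else `z`). -/
inductive CTerm (A : Type) : Type
  | atom : A → CTerm A
  | tt : CTerm A
  | ff : CTerm A
  | cond : CTerm A → CTerm A → CTerm A → CTerm A

/-- Derivability from the axiom set CP: the least congruence (w.r.t. the conditional)
on closed terms containing all closed substitution instances of (CP1)-(CP4). -/
inductive CPDer {A : Type} : CTerm A → CTerm A → Prop
  | refl (P) : CPDer P P
  | symm {P Q} : CPDer P Q → CPDer Q P
  | trans {P Q R} : CPDer P Q → CPDer Q R → CPDer P R
  | cond_congr {P P' Q Q' R R'} : CPDer P P' → CPDer Q Q' → CPDer R R' →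
      CPDer (.cond P Q R) (.cond P' Q' R')
  | CP1 (x y) : CPDer (.cond x .tt y) x
  | CP2 (x y) : CPDer (.cond x .ff y) y
  | CP3 (x) : CPDer (.cond .tt x .ff) x
  | CP4 (x y z u v) : CPDer (.cond x (.cond y z u) v)
      (.cond (.cond x y v) z (.cond x u v))

/-- The evaluation function `se : C_A → T_A` on conditional terms. -/
def seC {A : Type} : CTerm A → ETree A
  | .tt => .leafT
  | .ff => .leafF
  | .atom a => .node .leafT a .leafF
  | .cond P Q R => (seC Q).repl (seC P) (seC R)

theorem ETree.repl_repl {A : Type} (x y z u v : ETree A) :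
    (x.repl y z).repl u v = x.repl (y.repl u v) (z.repl u v) := by
  induction x with
  | leafT => rfl
  | leafF => rfl
  | node l a r ihl ihr => simp only [ETree.repl, ihl, ihr]

theorem ETree.repl_id {A : Type} (x : ETree A) :
    x.repl .leafT .leafF = x := by
  induction x with
  | leafT => rfl
  | leafF => rfl
  | node l a r ihl ihr => simp only [ETree.repl, ihl, ihr]

/-- The basic form (closed term) represented by an evaluation tree. -/
def ETree.toTerm {A : Type} : ETree A → CTerm A
  | .leafT => .tt
  | .leafF => .ff
  | .node l a r => .cond l.toTerm (.atom a) r.toTerm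

theorem CPDer.toTerm_repl {A : Type} (x y z : ETree A) :
    CPDer (.cond y.toTerm x.toTerm z.toTerm) (x.repl y z).toTerm := by
  induction x with
  | leafT => exact .CP1 _ _
  | leafF => exact .CP2 _ _
  | node l a r ihl ihr => exact (CPDer.CP4 _ _ _ _ _).trans (.cond_congr ihl (.refl _) ihr)

theorem CPDer.normal {A : Type} (P : CTerm A) : CPDer P (seC P).toTerm := by
  induction P with
  | atom a => exact (CPDer.CP3 _).symm
  | tt => exact .refl _
  | ff => exact .refl _
  | cond P Q R hP hQ hR => exact (CPDer.cond_congr hP hQ hR).trans (CPDer.toTerm_repl _ _ _)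

theorem CPDer.sound {A : Type} {P Q : CTerm A} (h : CPDer P Q) : seC P = seC Q := by
  induction h with
  | refl => rfl
  | symm _ ih => exact ih.symm
  | trans _ _ ih1 ih2 => exact ih1.trans ih2
  | cond_congr _ _ _ h1 h2 h3 => simp only [seC, h1, h2, h3]
  | CP1 => rfl
  | CP2 => rfl
  | CP3 x => exact ETree.repl_id _
  | CP4 x y z u v => exact ETree.repl_repl _ _ _ _ _

/-- Completeness of CP for closed terms: `CP ⊢ P = Q` iff `se(P) = se(Q)`. -/
theorem cp_complete {A : Type} [Nonempty A] (P Q : CTerm A) :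
    CPDer P Q ↔ seC P = seC Q := by
  refine ⟨CPDer.sound, fun h => ?_⟩
  have hP := CPDer.normal P
  rw [h] at hP
  exact hP.trans (CPDer.normal Q).symm
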